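/- Under the stated assumptions, for all sufficiently large N there exists, for each I ∈ 𝓘^N, a partition of I into consecutive subintervals J_1^I, …, J_{r_I}^I such that: (1) summ(J_k^I) ≤ 1/2 for every I ∈ 𝓘^N and every k ∈ {1,…,r_I}; and (2) ∑_{I ∈ 𝓘^N} ∑_{k=1}^{r_I} binom(|J_k^I|+1, 2) ≥ (1/2 − 4√2 · ε^{1/4})·N, where binom(k,2) = k(k−1)/2. -/

import Mathlib

open Finset Filter

open scoped Classical in
/-- The collection `𝓘^N` of maximal subintervals of `{1,…,N}` on which the gaps `g n` are at
most `1/2`, encoded as the set of pairs `(p, q)` of endpoints, `1 ≤ p ≤ q ≤ N`. -/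
noncomputable def maximalIntervals (g : ℕ → ℝ) (N : ℕ) : Finset (ℕ × ℕ) :=
  (Finset.Icc 1 N ×ˢ Finset.Icc 1 N).filter fun pq =>
    pq.1 ≤ pq.2 ∧ (∀ n ∈ Finset.Icc pq.1 pq.2, g n ≤ 1 / 2) ∧
      (pq.1 = 1 ∨ 1 / 2 < g (pq.1 - 1)) ∧ (pq.2 = N ∨ 1 / 2 < g (pq.2 + 1))

open scoped Classical in
noncomputable def ppGd (x : ℕ → ℝ) (p q : ℕ) : Finset (ℕ × ℕ) :=
  (Icc p q ×ˢ Icc p q).filter fun ij => ij.1 < ij.2 ∧ x ij.2 - x ij.1 ≤ 1 / 2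

open scoped Classical in
noncomputable def ppBd (x : ℕ → ℝ) (p q : ℕ) : Finset (ℕ × ℕ) :=
  (Icc p q ×ˢ Icc p q).filter fun ij =>
    ij.1 < ij.2 ∧ 1 / 2 < x ij.2 - x ij.1 ∧ x ij.2 - x ij.1 ≤ 3 / 2

def ppCut (x : ℕ → ℝ) (p q W : ℕ) : Prop :=
  ∃ (r : ℕ) (c : ℕ → ℕ), c 0 = p ∧ c r = q ∧ (∀ k < r, c k < c (k + 1)) ∧
    (∀ k < r, x (c (k + 1)) - x (c k) ≤ 1 / 2) ∧
    ∑ k ∈ range r, (c (k + 1) - c k + 1).choose 2 = W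

lemma ppCut_append {x : ℕ → ℝ} {p a q W V : ℕ} (h1 : ppCut x p a W) (h2 : ppCut x a q V) :
    ppCut x p q (W + V) := by
  obtain ⟨r, c, c0, cr, hc, hx, hW⟩ := h1
  obtain ⟨s, d, d0, ds, hd, hy, hV⟩ := h2
  have e1 : ∀ k, k ≤ r → (fun k => if k ≤ r then c k else d (k - r)) k = c k := by
    intro k hk; simp [hk]
  have e2 : ∀ k, (fun k => if k ≤ r then c k else d (k - r)) (r + k) = d k := by
    intro k
    rcases Nat.eq_zero_or_pos k with h | h
    · subst h; simp [cr, d0]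
    · have : ¬ (r + k ≤ r) := by omega
      simp [this]
  refine ⟨r + s, fun k => if k ≤ r then c k else d (k - r), ?_, ?_, ?_, ?_, ?_⟩
  · rw [e1 0 (by omega), c0]
  · rw [e2 s, ds]
  · intro k hk
    by_cases h : k < r
    · rw [e1 k (by omega), e1 (k + 1) (by omega)]; exact hc k h
    · obtain ⟨t, rfl⟩ : ∃ t, k = r + t := ⟨k - r, by omega⟩
      rw [add_assoc, e2 t, e2 (t + 1)]; exact hd t (by omega)
  · intro k hk
    by_cases h : k < r
    · rw [e1 k (by omega), e1 (k + 1) (by omega)]; exact hx k h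
    · obtain ⟨t, rfl⟩ : ∃ t, k = r + t := ⟨k - r, by omega⟩
      rw [add_assoc, e2 t, e2 (t + 1)]; exact hy t (by omega)
  · rw [sum_range_add, ← hW, ← hV]
    congr 1
    · apply sum_congr rfl
      intro k hk
      have := mem_range.1 hk
      rw [e1 k (by omega), e1 (k + 1) (by omega)]
    · apply sum_congr rfl
      intro k hk
      rw [add_assoc, e2 k, e2 (k + 1)]

lemma pp_card_rows (A B : Finset ℕ) (P : ℕ → ℕ → Prop)
    [DecidablePred fun ij : ℕ × ℕ => P ij.1 ij.2] [∀ i j, Decidable (P i j)] :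
    ((A ×ˢ B).filter fun ij => P ij.1 ij.2).card = ∑ i ∈ A, (B.filter fun j => P i j).card := by
  rw [card_filter, sum_product]
  simp only [card_filter]

lemma pp_card_cols (A B : Finset ℕ) (P : ℕ → ℕ → Prop)
    [DecidablePred fun ij : ℕ × ℕ => P ij.1 ij.2] [∀ i j, Decidable (P i j)] :
    ((A ×ˢ B).filter fun ij => P ij.1 ij.2).card = ∑ j ∈ B, (A.filter fun i => P i j).card := by
  rw [card_filter, sum_product_right]
  simp only [card_filter]

open scoped Classical in
lemma pp_left (x : ℕ → ℝ) (hx : ∀ i j, 1 ≤ i → i < j → x i < x j) (p q a m : ℕ) (hp : 1 ≤ p)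
    (hq : a + m ≤ q)
    (hm : x (a + m) - x a ≤ 1 / 2)
    (hmax : ∀ i j, p ≤ i → j ≤ q → i + m < j → 1 / 2 < x j - x i) :
    ((Ico p a ×ˢ Ioc a q).filter fun ij => x ij.2 - x ij.1 ≤ 1 / 2).card ≤
    100 * ((Ico p a ×ˢ Ioc a (a + m)).filter fun ij =>
      1 / 2 < x ij.2 - x ij.1 ∧ x ij.2 - x ij.1 ≤ 3 / 2).card + m * (m / 100) := by
  rw [pp_card_rows _ _ (fun i j => x j - x i ≤ 1 / 2),
    pp_card_rows _ _ (fun i j => 1 / 2 < x j - x i ∧ x j - x i ≤ 3 / 2), mul_sum]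
  have key : ∀ i ∈ Ico p a, ((Ioc a q).filter fun j => x j - x i ≤ 1 / 2).card ≤
      100 * ((Ioc a (a + m)).filter fun j => 1 / 2 < x j - x i ∧ x j - x i ≤ 3 / 2).card +
        (if 100 * (a - i) ≤ m then m else 0) := by
    intro i hi
    rw [mem_Ico] at hi
    by_cases hne : ((Ioc a q).filter fun j => x j - x i ≤ 1 / 2) = ∅
    · rw [hne]; simp
    obtain ⟨j0, hj0⟩ := nonempty_iff_ne_empty.2 hne
    rw [mem_filter, mem_Ioc] at hj0
    have hub : ((Ioc a q).filter fun j => x j - x i ≤ 1 / 2).card ≤ m := by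
      calc _ ≤ (Ioc a (a + m)).card := by
            apply card_le_card
            intro j hj
            rw [mem_filter, mem_Ioc] at hj
            rw [mem_Ioc]
            refine ⟨hj.1.1, ?_⟩
            by_contra hcon
            have := hmax i j hi.1 hj.1.2 (by omega)
            linarith [hj.2]
        _ = m := by simp
    split_ifs with h
    · omega
    · have hj0m : j0 ≤ i + m := by
        by_contra hcon
        have := hmax i j0 hi.1 hj0.1.2 (by omega)
        linarith [hj0.2]
      have hlb : a - i ≤
          ((Ioc a (a + m)).filter fun j => 1 / 2 < x j - x i ∧ x j - x i ≤ 3 / 2).card := by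
        calc a - i = (Ioc (i + m) (a + m)).card := by rw [Nat.card_Ioc]; omega
          _ ≤ _ := by
            apply card_le_card
            intro j hj
            rw [mem_Ioc] at hj
            rw [mem_filter, mem_Ioc]
            refine ⟨⟨by omega, hj.2⟩, hmax i j hi.1 (by omega) hj.1, ?_⟩
            have h1 : x j ≤ x (a + m) := by
              rcases hj.2.lt_or_eq with h | h
              · exact (hx _ _ (by omega) h).le
              · rw [h]
            have h2 := hx a j0 (by omega) hj0.1.1
            linarith [hj0.2]
      omega
  refine (sum_le_sum key).trans ?_
  rw [sum_add_distrib]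
  gcongr
  rw [← sum_filter, sum_const, smul_eq_mul, mul_comm]
  gcongr
  calc _ ≤ (Ico (a - m / 100) a).card := by
        apply card_le_card
        intro i hi
        rw [mem_filter, mem_Ico] at hi
        rw [mem_Ico]
        omega
    _ ≤ m / 100 := by rw [Nat.card_Ico]; omega

open scoped Classical in
lemma pp_right (x : ℕ → ℝ) (hx : ∀ i j, 1 ≤ i → i < j → x i < x j) (p q a m : ℕ) (hp : 1 ≤ p)
    (ha : p ≤ a)
    (hm : x (a + m) - x a ≤ 1 / 2)
    (hmax : ∀ i j, p ≤ i → j ≤ q → i + m < j → 1 / 2 < x j - x i) :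
    ((Ico p (a + m) ×ˢ Ioc (a + m) q).filter fun ij => x ij.2 - x ij.1 ≤ 1 / 2).card ≤
    100 * ((Ico a (a + m) ×ˢ Ioc (a + m) q).filter fun ij =>
      1 / 2 < x ij.2 - x ij.1 ∧ x ij.2 - x ij.1 ≤ 3 / 2).card + m * (m / 100) := by
  rw [pp_card_cols _ _ (fun i j => x j - x i ≤ 1 / 2),
    pp_card_cols _ _ (fun i j => 1 / 2 < x j - x i ∧ x j - x i ≤ 3 / 2), mul_sum]
  have key : ∀ j ∈ Ioc (a + m) q, ((Ico p (a + m)).filter fun i => x j - x i ≤ 1 / 2).card ≤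
      100 * ((Ico a (a + m)).filter fun i => 1 / 2 < x j - x i ∧ x j - x i ≤ 3 / 2).card +
        (if 100 * (j - (a + m)) ≤ m then m else 0) := by
    intro j hj
    rw [mem_Ioc] at hj
    by_cases hne : ((Ico p (a + m)).filter fun i => x j - x i ≤ 1 / 2) = ∅
    · rw [hne]; simp
    obtain ⟨j0, hj0⟩ := nonempty_iff_ne_empty.2 hne
    rw [mem_filter, mem_Ico] at hj0
    have hub : ((Ico p (a + m)).filter fun i => x j - x i ≤ 1 / 2).card ≤ m := by
      calc _ ≤ (Ico a (a + m)).card := by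
            apply card_le_card
            intro i hi
            rw [mem_filter, mem_Ico] at hi
            rw [mem_Ico]
            refine ⟨?_, hi.1.2⟩
            by_contra hcon
            have := hmax i j hi.1.1 hj.2 (by omega)
            linarith [hi.2]
        _ = m := by simp
    split_ifs with h
    · omega
    · have hj0m : j ≤ j0 + m := by
        by_contra hcon
        have := hmax j0 j hj0.1.1 hj.2 (by omega)
        linarith [hj0.2]
      have hlb : j - (a + m) ≤
          ((Ico a (a + m)).filter fun i => 1 / 2 < x j - x i ∧ x j - x i ≤ 3 / 2).card := by
        calc j - (a + m) = (Ico a (j - m)).card := by rw [Nat.card_Ico]; omega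
          _ ≤ _ := by
            apply card_le_card
            intro i hi
            rw [mem_Ico] at hi
            rw [mem_filter, mem_Ico]
            refine ⟨⟨hi.1, by omega⟩, hmax i j (by omega) hj.2 (by omega), ?_⟩
            have h1 : x a ≤ x i := by
              rcases hi.1.lt_or_eq with h | h
              · exact (hx _ _ (by omega) h).le
              · rw [h]
            have h2 := hx j0 (a + m) (by omega) hj0.1.2
            linarith [hj0.2]
      omega
  refine (sum_le_sum key).trans ?_
  rw [sum_add_distrib]
  gcongr
  rw [← sum_filter, sum_const, smul_eq_mul, mul_comm]
  gcongr
  calc _ ≤ (Ioc (a + m) (a + m + m / 100)).card := by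
        apply card_le_card
        intro i hi
        rw [mem_filter, mem_Ioc] at hi
        rw [mem_Ioc]
        omega
    _ ≤ m / 100 := by rw [Nat.card_Ioc]; omega

lemma pp_pairs_le (s : Finset (ℕ × ℕ)) (a m : ℕ)
    (hs : ∀ ij ∈ s, a ≤ ij.1 ∧ ij.1 < ij.2 ∧ ij.2 ≤ a + m) : s.card ≤ (m + 1).choose 2 := by
  have h1 : s.card ≤ (powersetCard 2 (Icc a (a + m))).card := by
    apply card_le_card_of_injOn (fun ij => {ij.1, ij.2})
    · intro ij hij
      have := hs ij hij
      rw [mem_coe, mem_powersetCard]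
      refine ⟨?_, card_pair (by omega)⟩
      intro t ht
      simp only [mem_insert, mem_singleton] at ht
      rw [mem_Icc]; omega
    · rintro ⟨i, j⟩ hij ⟨i', j'⟩ hij' h
      have h1 := hs _ hij
      have h2 := hs _ hij'
      simp only at h h1 h2
      have hi : i ∈ ({i', j'} : Finset ℕ) := by rw [← h]; simp
      have hj : j ∈ ({i', j'} : Finset ℕ) := by rw [← h]; simp
      simp only [mem_insert, mem_singleton] at hi hj
      ext <;> simp <;> omega
  rw [card_powersetCard, Nat.card_Icc] at h1
  convert h1 using 2
  omega

lemma pp_seg (x : ℕ → ℝ) (hx : ∀ i j, 1 ≤ i → i < j → x i < x j) (n : ℕ) : ∀ p q : ℕ, 1 ≤ p →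
    p ≤ q → q - p = n → (∀ i, p ≤ i → i < q → x (i + 1) - x i ≤ 1 / 2) →
    ∃ W, ppCut x p q W ∧ 100 * (ppGd x p q).card ≤ 104 * W + 10000 * (ppBd x p q).card := by
  classical
  induction n using Nat.strong_induction_on with
  | _ n ih =>
  intro p q hp hpq hn hg
  rcases hpq.eq_or_lt with rfl | hlt
  · refine ⟨0, ⟨0, fun _ => p, rfl, rfl, by simp, by simp, by simp⟩, ?_⟩
    have : ppGd x p p = ∅ := by
      ext ⟨i, j⟩
      simp [ppGd]
      omega
    simp [this]
  set S : ℕ → Prop := fun m => ∃ a, p ≤ a ∧ a + m ≤ q ∧ x (a + m) - x a ≤ 1 / 2 with hS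
  have hS1 : S 1 := ⟨p, le_rfl, hlt, hg p le_rfl hlt⟩
  set m := Nat.findGreatest S q with hmdef
  have hm1 : 1 ≤ m := Nat.le_findGreatest (by omega) hS1
  obtain ⟨a, hpa, haq, hm⟩ : S m := Nat.findGreatest_spec (m := 1) (by omega) hS1
  have hmax : ∀ i j, p ≤ i → j ≤ q → i + m < j → 1 / 2 < x j - x i := by
    intro i j hi hj hij
    by_contra hcon
    have : S (j - i) := ⟨i, hi, by omega, by
      rw [show i + (j - i) = j by omega]; linarith⟩
    have := Nat.le_findGreatest (P := S) (n := q) (by omega) this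
    omega
  obtain ⟨W1, hc1, hb1⟩ := ih (a - p) (by omega) p a hp hpa rfl
    (fun i h1 h2 => hg i h1 (by omega))
  obtain ⟨W2, hc2, hb2⟩ := ih (q - (a + m)) (by omega) (a + m) q (by omega) haq rfl
    (fun i h1 h2 => hg i (by omega) h2)
  have hc : ppCut x a (a + m) ((m + 1).choose 2) := by
    refine ⟨1, fun k => a + k * m, by simp, by simp, ?_, ?_, ?_⟩
    · intro k hk
      obtain rfl : k = 0 := by omega
      simp; omega
    · intro k hk
      obtain rfl : k = 0 := by omega
      simpa using hm
    · simp
  refine ⟨_, ppCut_append (ppCut_append hc1 hc) hc2, ?_⟩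
  have hL := pp_left x hx p q a m hp haq hm hmax
  have hR := pp_right x hx p q a m hp hpa hm hmax
  have hmm : m * (m / 100) * 100 ≤ 2 * (m + 1).choose 2 := by
    have h1 : 2 * (m + 1).choose 2 = (m + 1) * m := by
      have := Nat.triangle_succ m
      rw [Nat.choose_two_right]
      have h2 : 2 ∣ (m + 1) * (m + 1 - 1) := (Nat.even_mul_pred_self _).two_dvd
      rw [Nat.mul_div_cancel' h2]; simp
    rw [h1]
    have := Nat.div_mul_le_self m 100
    nlinarith
  set gL := (Ico p a ×ˢ Ioc a q).filter fun ij => x ij.2 - x ij.1 ≤ 1 / 2 with hgL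
  set gR := (Ico p (a + m) ×ˢ Ioc (a + m) q).filter fun ij => x ij.2 - x ij.1 ≤ 1 / 2 with hgR
  set BL := (Ico p a ×ˢ Ioc a (a + m)).filter fun ij =>
      1 / 2 < x ij.2 - x ij.1 ∧ x ij.2 - x ij.1 ≤ 3 / 2 with hBL
  set BR := (Ico a (a + m) ×ˢ Ioc (a + m) q).filter fun ij =>
      1 / 2 < x ij.2 - x ij.1 ∧ x ij.2 - x ij.1 ≤ 3 / 2 with hBR
  have hM : (ppGd x a (a + m)).card ≤ (m + 1).choose 2 := by
    apply pp_pairs_le _ a m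
    rintro ⟨i, j⟩ hij
    simp only [ppGd, mem_filter, mem_product, mem_Icc] at hij
    simp only
    omega
  have hG : (ppGd x p q).card ≤ (ppGd x p a).card + (ppGd x a (a + m)).card +
      (ppGd x (a + m) q).card + gL.card + gR.card := by
    have : ppGd x p q ⊆ ppGd x p a ∪ ppGd x a (a + m) ∪ ppGd x (a + m) q ∪ gL ∪ gR := by
      rintro ⟨i, j⟩ hij
      simp only [ppGd, hgL, hgR, mem_union, mem_filter, mem_product, mem_Icc, mem_Ico,
        mem_Ioc] at hij ⊢
      have h3 := hij.2.2
      simp only [h3, and_true]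
      omega
    refine (card_le_card this).trans ?_
    refine (card_union_le _ _).trans ?_
    gcongr
    refine (card_union_le _ _).trans ?_
    gcongr
    refine (card_union_le _ _).trans ?_
    gcongr
    exact card_union_le _ _
  have hB : (ppBd x p a).card + (ppBd x (a + m) q).card + BL.card + BR.card ≤
      (ppBd x p q).card := by
    have d1 : Disjoint (ppBd x p a) (ppBd x (a + m) q) := by
      rw [disjoint_left]
      rintro ⟨i, j⟩ h1 h2
      simp only [ppBd, mem_filter, mem_product, mem_Icc] at h1 h2
      omega
    have d2 : Disjoint (ppBd x p a ∪ ppBd x (a + m) q) BL := by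
      rw [disjoint_left]
      rintro ⟨i, j⟩ h1 h2
      simp only [ppBd, hBL, mem_union, mem_filter, mem_product, mem_Icc, mem_Ico,
        mem_Ioc] at h1 h2
      omega
    have d3 : Disjoint (ppBd x p a ∪ ppBd x (a + m) q ∪ BL) BR := by
      rw [disjoint_left]
      rintro ⟨i, j⟩ h1 h2
      simp only [ppBd, hBL, hBR, mem_union, mem_filter, mem_product, mem_Icc, mem_Ico,
        mem_Ioc] at h1 h2
      omega
    rw [← card_union_of_disjoint d1, ← card_union_of_disjoint d2, ← card_union_of_disjoint d3]
    apply card_le_card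
    rintro ⟨i, j⟩ h
    simp only [ppBd, hBL, hBR, mem_union, mem_filter, mem_product, mem_Icc, mem_Ico,
        mem_Ioc] at h ⊢
    have h3 : 1 / 2 < x j - x i ∧ x j - x i ≤ 3 / 2 := by tauto
    refine ⟨?_, ?_, h3⟩ <;> omega
  omega

lemma pp_maxint (g : ℕ → ℝ) (N i k : ℕ) (hi : 1 ≤ i) (hik : i ≤ k) (hk : k ≤ N)
    (h : ∀ n, i ≤ n → n ≤ k → g n ≤ 1 / 2) :
    ∃ pq ∈ maximalIntervals g N, pq.1 ≤ i ∧ k ≤ pq.2 := by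
  classical
  set P : ℕ → Prop := fun p => 1 ≤ p ∧ p ≤ i ∧ ∀ n, p ≤ n → n ≤ i → g n ≤ 1 / 2 with hP
  have hex : ∃ p, P p := ⟨i, hi, le_rfl, fun n h1 h2 => h n h1 (by omega)⟩
  set Q : ℕ → Prop := fun q => k ≤ q ∧ ∀ n, k ≤ n → n ≤ q → g n ≤ 1 / 2 with hQ
  have hQk : Q k := ⟨le_rfl, fun n h1 h2 => h n (by omega) h2⟩
  set p := Nat.find hex with hp
  obtain ⟨p1, p2, p3⟩ : P p := Nat.find_spec hex
  set q := Nat.findGreatest Q N with hq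
  obtain ⟨q1, q2⟩ : Q q := Nat.findGreatest_spec hk hQk
  have q3 : q ≤ N := Nat.findGreatest_le N
  refine ⟨(p, q), ?_, p2, q1⟩
  simp only [maximalIntervals, mem_filter, mem_product, mem_Icc]
  refine ⟨by omega, by omega, ?_, ?_, ?_⟩
  · rintro n ⟨h1, h2⟩
    by_cases c1 : n ≤ i
    · exact p3 n h1 c1
    by_cases c2 : n ≤ k
    · exact h n (by omega) c2
    · exact q2 n (by omega) h2
  · by_contra hcon
    push Not at hcon
    have : P (p - 1) := ⟨by omega, by omega, fun n h1 h2 => by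
      rcases Nat.eq_or_lt_of_le h1 with h1 | h1
      · rw [← h1]; exact hcon.2
      · exact p3 n (by omega) h2⟩
    exact Nat.find_min hex (m := p - 1) (by omega) this
  · by_contra hcon
    push Not at hcon
    have : Q (q + 1) := ⟨by omega, fun n h1 h2 => by
      rcases Nat.eq_or_lt_of_le h2 with h2 | h2
      · rw [h2]; exact hcon.2
      · exact q2 n h1 (by omega)⟩
    have := Nat.le_findGreatest (P := Q) (n := N) (by omega) this
    omega

lemma pp_maxint_unique (g : ℕ → ℝ) (N i : ℕ) (u v : ℕ × ℕ) (hu : u ∈ maximalIntervals g N)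
    (hv : v ∈ maximalIntervals g N) (h1 : u.1 ≤ i) (h2 : i ≤ u.2) (h3 : v.1 ≤ i) (h4 : i ≤ v.2) :
    u = v := by
  simp only [maximalIntervals, mem_filter, mem_product, mem_Icc] at hu hv
  obtain ⟨u1, u2, u3, u4, u5⟩ := hu
  obtain ⟨v1, v2, v3, v4, v5⟩ := hv
  ext
  · rcases lt_trichotomy u.1 v.1 with h | h | h
    · have := u3 (v.1 - 1) (by omega)
      rcases v4 with h' | h'
      · omega
      · linarith
    · exact h
    · have := v3 (u.1 - 1) (by omega)
      rcases u4 with h' | h'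
      · omega
      · linarith
  · rcases lt_trichotomy u.2 v.2 with h | h | h
    · have := v3 (u.2 + 1) (by omega)
      rcases u5 with h' | h'
      · omega
      · linarith
    · exact h
    · have := u3 (v.2 + 1) (by omega)
      rcases v5 with h' | h'
      · omega
      · linarith

open scoped Classical in
noncomputable def ppCnt (x : ℕ → ℝ) (a b : ℝ) (N : ℕ) : Finset (ℕ × ℕ) :=
  (Icc 1 (N + 1) ×ˢ Icc 1 (N + 1)).filter fun ij =>
    ij.1 ≠ ij.2 ∧ a < x ij.2 - x ij.1 ∧ x ij.2 - x ij.1 ≤ b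

open scoped Classical in
lemma pp_cnt (lam : ℕ → ℝ) (hppc : ∀ I : Set ℝ, I.OrdConnected → Bornology.IsBounded I →
      Tendsto (fun N : ℕ =>
          (((Finset.Icc 1 N ×ˢ Finset.Icc 1 N).filter
            (fun p => p.1 ≠ p.2 ∧ lam p.2 - lam p.1 ∈ I)).card : ℝ) / N)
        atTop (nhds (MeasureTheory.volume I).toReal)) (a b : ℝ) (hab : a ≤ b) :
    Tendsto (fun N : ℕ => ((ppCnt lam a b N).card : ℝ) / N) atTop (nhds (b - a)) := by
  have h := hppc (Set.Ioc a b) Set.ordConnected_Ioc (Metric.isBounded_Ioc a b)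
  rw [Real.volume_Ioc, ENNReal.toReal_ofReal (by linarith)] at h
  have h1 := (tendsto_add_atTop_iff_nat 1).2 h
  have h2 : Tendsto (fun N : ℕ => 1 + 1 / (N : ℝ)) atTop (nhds (1 + 0)) :=
    tendsto_const_nhds.add tendsto_one_div_atTop_nhds_zero_nat
  have h3 := h1.mul h2
  rw [add_zero, mul_one] at h3
  refine h3.congr' ?_
  filter_upwards [eventually_gt_atTop 0] with N hN
  have hN' : (N : ℝ) ≠ 0 := by positivity
  have hN1 : (N : ℝ) + 1 ≠ 0 := by positivity
  have e : (ppCnt lam a b N) = ((Finset.Icc 1 (N + 1) ×ˢ Finset.Icc 1 (N + 1)).filter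
            (fun p => p.1 ≠ p.2 ∧ lam p.2 - lam p.1 ∈ Set.Ioc a b)) := by
    ext ⟨i, j⟩
    simp [ppCnt]
  rw [e]
  push_cast
  field_simp
  congr!

lemma pp_ev_le {f : ℕ → ℝ} {l c : ℝ} (h : Tendsto (fun N : ℕ => f N / N) atTop (nhds l))
    (hc : l < c) : ∀ᶠ N : ℕ in atTop, f N ≤ c * N := by
  filter_upwards [h.eventually_lt_const hc, eventually_gt_atTop 0] with N h1 h2
  have : (0 : ℝ) < N := by exact_mod_cast h2
  rw [div_lt_iff₀ this] at h1
  exact h1.le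

lemma pp_ev_ge {f : ℕ → ℝ} {l c : ℝ} (h : Tendsto (fun N : ℕ => f N / N) atTop (nhds l))
    (hc : c < l) : ∀ᶠ N : ℕ in atTop, c * N ≤ f N := by
  filter_upwards [h.eventually_const_lt hc, eventually_gt_atTop 0] with N h1 h2
  have : (0 : ℝ) < N := by exact_mod_cast h2
  rw [lt_div_iff₀ this] at h1
  exact h1.le

open scoped Classical in
lemma pp_det (g : ℕ → ℝ) (N M : ℕ) (T η τ h : ℝ) (hM : 0 < M) (hη : 0 ≤ η) (hh : 0 < h)
    (hhM : h * M = 1 - η) (hT : 3 / 2 ≤ T)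
    (hcount : ∀ k ∈ Icc 1 M, (((Icc 1 N).filter fun n => T - k * h < g n).card : ℝ) ≤
      (k * h + τ) * N)
    (hsum : (1 - τ) * N ≤ ∑ n ∈ Icc 1 N, g n)
    (hgT : ∀ n ∈ Icc 1 N, g n ≤ T) :
    η * (((Icc 1 N).filter fun n => g n ≤ 1 / 2).card : ℝ) ≤
      ((T - 1 + τ) - (1 - η) * (1 - τ) + (1 - η) ^ 2 / 2 + h * (1 - η) / 2) * N := by
  have hpt : ∀ n ∈ Icc 1 N, h * (((Icc 1 M).filter fun k : ℕ => g n ≤ T - k * h).card : ℝ) +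
      η * (if g n ≤ 1 / 2 then 1 else 0) ≤ T - g n := by
    intro n hn
    split_ifs with hc
    · have h1 : (((Icc 1 M).filter fun k : ℕ => g n ≤ T - k * h).card : ℝ) ≤ M := by
        have := card_filter_le (Icc 1 M) (fun k : ℕ => g n ≤ T - k * h)
        rw [Nat.card_Icc] at this
        exact_mod_cast this
      have := mul_le_mul_of_nonneg_left h1 hh.le
      linarith
    · have hu : 0 ≤ (T - g n) / h := div_nonneg (by linarith [hgT n hn]) hh.le
      have h1 : (((Icc 1 M).filter fun k : ℕ => g n ≤ T - k * h).card : ℝ) ≤ (T - g n) / h := by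
        refine le_trans ?_ (Nat.floor_le hu)
        have : ((Icc 1 M).filter fun k : ℕ => g n ≤ T - k * h).card ≤
            (Icc 1 ⌊(T - g n) / h⌋₊).card := by
          apply card_le_card
          intro k hk
          rw [mem_filter, mem_Icc] at hk
          rw [mem_Icc]
          refine ⟨hk.1.1, Nat.le_floor ?_⟩
          rw [le_div_iff₀ hh]
          linarith [hk.2]
        rw [Nat.card_Icc] at this
        exact_mod_cast this
      have := mul_le_mul_of_nonneg_left h1 hh.le
      rw [mul_div_cancel₀ _ hh.ne'] at this
      linarith
  have hs := sum_le_sum hpt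
  rw [sum_add_distrib, ← mul_sum, ← mul_sum, sum_sub_distrib, sum_const, Nat.card_Icc,
    sum_boole] at hs
  have hswap : ∑ n ∈ Icc 1 N, (((Icc 1 M).filter fun k : ℕ => g n ≤ T - k * h).card : ℝ) =
      ∑ k ∈ Icc 1 M, (((Icc 1 N).filter fun n : ℕ => g n ≤ T - k * h).card : ℝ) := by
    simp only [card_filter, Nat.cast_sum]
    rw [sum_comm]
  have hk : ∀ k ∈ Icc 1 M, (1 - k * h - τ) * N ≤
      (((Icc 1 N).filter fun n : ℕ => g n ≤ T - k * h).card : ℝ) := by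
    intro k hk
    have h1 := hcount k hk
    have h2 := card_filter_add_card_filter_not (s := Icc 1 N) (fun n : ℕ => g n ≤ T - k * h)
    simp only [not_le] at h2
    rw [Nat.card_Icc] at h2
    have h3 : (((Icc 1 N).filter fun n : ℕ => g n ≤ T - k * h).card : ℝ) +
      (((Icc 1 N).filter fun n => T - k * h < g n).card : ℝ) = N := by exact_mod_cast h2
    linarith
  have hs2 := sum_le_sum hk
  have hgauss : ∀ M : ℕ, ∑ k ∈ Icc 1 M, (1 - (k : ℝ) * h - τ) * N =
      (M * (1 - τ) - h * (M * (M + 1) / 2)) * N := by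
    intro M
    induction M with
    | zero => simp
    | succ M ih => rw [sum_Icc_succ_top (by omega), ih]; push_cast; ring
  rw [hgauss] at hs2
  rw [hswap] at hs
  have hs3 := mul_le_mul_of_nonneg_left hs2 hh.le
  have e : h * ((M * (1 - τ) - h * (M * (M + 1) / 2)) * N) =
      ((1 - η) * (1 - τ) - (1 - η) ^ 2 / 2 - h * (1 - η) / 2) * N := by
    rw [← hhM]; ring
  rw [e] at hs3
  simp only [add_tsub_cancel_right, nsmul_eq_mul] at hs
  nlinarith

open scoped Classical in
lemma pp_small (lam : ℕ → ℝ) (g : ℕ → ℝ) (hgdef : ∀ n, g n = lam (n + 1) - lam n)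
    (havg : Tendsto (fun N : ℕ => (∑ n ∈ Finset.Icc 1 N, g n) / N) atTop (nhds 1))
    (hcnt : ∀ a b : ℝ, a ≤ b →
      Tendsto (fun N : ℕ => ((ppCnt lam a b N).card : ℝ) / N) atTop (nhds (b - a)))
    (ε : ℝ) (hε : ε = 1 / 10 ^ 9)
    (hgap : ∀ n, 1 ≤ n → g n ≤ 3 / 2 + ε) :
    ∀ᶠ N : ℕ in atTop, (((Icc 1 N).filter fun n => g n ≤ 1 / 2).card : ℝ) ≤ 5 / 10 ^ 5 * N := by
  obtain ⟨M, hM⟩ : ∃ M : ℕ, M = 10 ^ 10 := ⟨_, rfl⟩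
  have hMR : (M : ℝ) = 10 ^ 10 := by rw [hM]; norm_num
  obtain ⟨h, hh⟩ : ∃ h : ℝ, h = (1 - 5 / 10 ^ 5) / 10 ^ 10 := ⟨_, rfl⟩
  have hh0 : 0 < h := by rw [hh]; norm_num
  have hk : ∀ᶠ N : ℕ in atTop, ∀ k ∈ Icc 1 M,
      ((ppCnt lam (3 / 2 + ε - k * h) (3 / 2 + ε) N).card : ℝ) ≤ (k * h + 1 / 10 ^ 11) * N := by
    rw [eventually_all_finset]
    intro k hk
    have hkh : 0 ≤ k * h := by positivity
    apply pp_ev_le (hcnt _ _ (by linarith))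
    have : (0 : ℝ) < 1 / 10 ^ 11 := by positivity
    linarith
  have hs := pp_ev_ge havg (c := 1 - 1 / 10 ^ 11) (by norm_num)
  filter_upwards [hk, hs] with N h1 h2
  have := pp_det g N M (3 / 2 + ε) (5 / 10 ^ 5) (1 / 10 ^ 11) h (by rw [hM]; positivity)
    (by norm_num) hh0 (by rw [hMR, hh]; norm_num) (by rw [hε]; norm_num) ?_ h2
    (fun n hn => hgap n (mem_Icc.1 hn).1)
  · have hN : (0 : ℝ) ≤ N := Nat.cast_nonneg N
    rw [hε, hh] at this
    nlinarith
  · intro k hk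
    refine le_trans ?_ (h1 k hk)
    norm_cast
    apply card_le_card_of_injOn (fun n => (n, n + 1))
    · intro n hn
      rw [mem_coe, mem_filter, mem_Icc] at hn
      rw [mem_coe]
      simp only [ppCnt, mem_filter, mem_product, mem_Icc]
      rw [← hgdef]
      exact ⟨by omega, by omega, hn.2, hgap n hn.1.1⟩
    · intro n _ n' _ hnn
      simpa using congrArg Prod.fst hnn

open scoped Classical in
/-- Let `(λ_n)` be strictly increasing with average gap `1` and Poisson pair correlations,
let `ε = 10⁻⁹`, and suppose `g n := λ_{n+1} − λ_n ≤ 3/2 + ε` for all `n ≥ 1`. Then for all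
sufficiently large `N` there exists, for each `I = (p,q) ∈ 𝓘^N`, a partition of `I` into
`r I` consecutive nonempty subintervals `J_k^I = {e I (k-1) + 1, …, e I k}` (with cut points
`e I 0 = p − 1 < e I 1 < ⋯ < e I (r I) = q`) such that:
(1) `summ(J_k^I) ≤ 1/2` for all `I` and `k`, and
(2) `∑_{I ∈ 𝓘^N} ∑_{k=1}^{r I} C(|J_k^I|+1, 2) ≥ (1/2 − 4√2·ε^{1/4})·N`. -/
theorem stmt_10 (lam : ℕ → ℝ) (g : ℕ → ℝ) (hgdef : ∀ n, g n = lam (n + 1) - lam n)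
    (hmono : ∀ n, 1 ≤ n → lam n < lam (n + 1))
    (havg : Tendsto (fun N : ℕ => (∑ n ∈ Finset.Icc 1 N, g n) / N) atTop (nhds 1))
    (hppc : ∀ I : Set ℝ, I.OrdConnected → Bornology.IsBounded I →
      Tendsto (fun N : ℕ =>
          (((Finset.Icc 1 N ×ˢ Finset.Icc 1 N).filter
            (fun p => p.1 ≠ p.2 ∧ lam p.2 - lam p.1 ∈ I)).card : ℝ) / N)
        atTop (nhds (MeasureTheory.volume I).toReal))
    (ε : ℝ) (hε : ε = 1 / 10 ^ 9)
    (hgap : ∀ n, 1 ≤ n → g n ≤ 3 / 2 + ε) :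
    ∀ᶠ N : ℕ in atTop, ∃ (r : ℕ × ℕ → ℕ) (e : ℕ × ℕ → ℕ → ℕ),
      (∀ pq ∈ maximalIntervals g N,
        1 ≤ r pq ∧ e pq 0 = pq.1 - 1 ∧ e pq (r pq) = pq.2 ∧
        (∀ k < r pq, e pq k < e pq (k + 1)) ∧
        (∀ k, 1 ≤ k → k ≤ r pq →
          ∑ i ∈ Finset.Icc (e pq (k - 1) + 1) (e pq k), g i ≤ 1 / 2)) ∧
      (1 / 2 - 4 * Real.sqrt 2 * ε ^ ((1 : ℝ) / 4)) * N ≤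
        ∑ pq ∈ maximalIntervals g N, ∑ k ∈ Finset.Icc 1 (r pq),
          ((e pq k - e pq (k - 1) + 1).choose 2 : ℝ) := by
  classical
  have hcnt := pp_cnt lam hppc
  have hx : ∀ i j, 1 ≤ i → i < j → lam i < lam j := by
    intro i j hi hij
    induction j, hij using Nat.le_induction with
    | base => exact hmono i hi
    | succ j hj ih => exact ih.trans (hmono j (by omega))
  have hD := pp_small lam g hgdef havg hcnt ε hε hgap
  have hG := pp_ev_ge (hcnt 0 (1 / 2) (by norm_num)) (c := 1 / 2 - 1 / 10 ^ 6) (by norm_num)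
  have hB := pp_ev_le (hcnt (1 / 2) (3 / 2 + ε) (by rw [hε]; norm_num))
    (c := 1 + 1 / 10 ^ 6) (by rw [hε]; norm_num)
  filter_upwards [hD, hG, hB] with N hD hG hB
  have hseg : ∀ pq : ℕ × ℕ, ∃ (r : ℕ) (c : ℕ → ℕ), pq ∈ maximalIntervals g N →
      c 0 = pq.1 ∧ c r = pq.2 + 1 ∧ (∀ k < r, c k < c (k + 1)) ∧
      (∀ k < r, lam (c (k + 1)) - lam (c k) ≤ 1 / 2) ∧
      100 * (ppGd lam pq.1 (pq.2 + 1)).card ≤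
        104 * ∑ k ∈ range r, (c (k + 1) - c k + 1).choose 2 +
        10000 * (ppBd lam pq.1 (pq.2 + 1)).card := by
    intro pq
    by_cases hpq : pq ∈ maximalIntervals g N
    · have hpq' := hpq
      simp only [maximalIntervals, mem_filter, mem_product, mem_Icc] at hpq'
      obtain ⟨W, ⟨r, c, h1, h2, h3, h4, h5⟩, h6⟩ := pp_seg lam hx _ pq.1 (pq.2 + 1) (by omega)
        (by omega) rfl (fun i hi1 hi2 => by
          rw [← hgdef]; exact hpq'.2.2.1 i ⟨hi1, by omega⟩)
      exact ⟨r, c, fun _ => ⟨h1, h2, h3, h4, by rw [h5]; exact h6⟩⟩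
    · exact ⟨0, fun _ => 0, fun h => absurd h hpq⟩
  choose r c hrc using hseg
  refine ⟨r, fun pq k => c pq k - 1, ?_, ?_⟩
  · intro pq hpq
    obtain ⟨h1, h2, h3, h4, h5⟩ := hrc pq hpq
    simp only [maximalIntervals, mem_filter, mem_product, mem_Icc] at hpq
    have hpos : ∀ k ≤ r pq, 1 ≤ c pq k := by
      intro k
      induction k with
      | zero => intro _; omega
      | succ k ih => intro hk; have := ih (by omega); have := h3 k (by omega); omega
    refine ⟨?_, by simp only [h1], by simp only [h2, Nat.add_sub_cancel], ?_, ?_⟩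
    · by_contra hcon
      have : r pq = 0 := by omega
      rw [this] at h2
      omega
    · intro k hk
      have := h3 k hk
      have := hpos k hk.le
      simp only
      omega
    · intro k hk1 hk2
      obtain ⟨t, rfl⟩ : ∃ t, k = t + 1 := ⟨k - 1, by omega⟩
      simp only [Nat.add_sub_cancel]
      have a1 := hpos t (by omega)
      have a2 := h3 t (by omega)
      refine le_trans (le_of_eq ?_) (h4 t (by omega))
      rw [Nat.sub_add_cancel a1]
      have e : Icc (c pq t) (c pq (t + 1) - 1) = Ico (c pq t) (c pq (t + 1)) := by
        ext z; rw [mem_Icc, mem_Ico]; omega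
      rw [e]
      simp only [hgdef]
      exact sum_Ico_sub lam a2.le
  · have hW : ∀ pq ∈ maximalIntervals g N, ∑ k ∈ Finset.Icc 1 (r pq),
          (((c pq k - 1) - (c pq (k - 1) - 1) + 1).choose 2 : ℝ) =
          ((∑ k ∈ range (r pq), (c pq (k + 1) - c pq k + 1).choose 2 : ℕ) : ℝ) := by
      intro pq hpq
      obtain ⟨h1, h2, h3, h4, h5⟩ := hrc pq hpq
      simp only [maximalIntervals, mem_filter, mem_product, mem_Icc] at hpq
      have hpos : ∀ k ≤ r pq, 1 ≤ c pq k := by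
        intro k
        induction k with
        | zero => intro _; omega
        | succ k ih => intro hk; have := ih (by omega); have := h3 k (by omega); omega
      rw [Nat.cast_sum, range_eq_Ico]
      have e : Icc 1 (r pq) = Ico (0 + 1) (r pq + 1) := by
        ext z; rw [mem_Icc, mem_Ico]; omega
      rw [e, ← sum_Ico_add']
      apply sum_congr rfl
      intro k hk
      rw [mem_Ico] at hk
      have a1 := hpos k (by omega)
      have a2 := h3 k (by omega)
      simp only [Nat.add_sub_cancel]
      congr 3
      omega
    rw [sum_congr rfl hW, ← Nat.cast_sum]
    have hGt : (ppCnt lam 0 (1 / 2) N).card ≤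
        ∑ pq ∈ maximalIntervals g N, (ppGd lam pq.1 (pq.2 + 1)).card := by
      refine le_trans (card_le_card ?_) card_biUnion_le
      rintro ⟨i, j⟩ hij
      simp only [ppCnt, mem_filter, mem_product, mem_Icc] at hij
      obtain ⟨⟨hi, hj⟩, hne, hlt, hle⟩ := hij
      have hij : i < j := by
        rcases lt_trichotomy i j with h | h | h
        · exact h
        · exact absurd h hne
        · have := hx j i hj.1 h; linarith
      obtain ⟨pq, hpq, b1, b2⟩ := pp_maxint g N i (j - 1) hi.1 (by omega) (by omega) (by
        intro n n1 n2
        rw [hgdef]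
        have c1 : lam i ≤ lam n := by
          rcases n1.eq_or_lt with h | h
          · rw [h]
          · exact (hx _ _ hi.1 h).le
        have c2 : lam (n + 1) ≤ lam j := by
          rcases (show n + 1 ≤ j by omega).eq_or_lt with h | h
          · rw [h]
          · exact (hx _ _ (by omega) h).le
        linarith)
      rw [mem_biUnion]
      refine ⟨pq, hpq, ?_⟩
      simp only [ppGd, mem_filter, mem_product, mem_Icc]
      exact ⟨by omega, hij, hle⟩
    have hBt : ∑ pq ∈ maximalIntervals g N, (ppBd lam pq.1 (pq.2 + 1)).card +
        ((Icc 1 N).filter fun n => ¬ g n ≤ 1 / 2).card ≤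
        (ppCnt lam (1 / 2) (3 / 2 + ε) N).card := by
      rw [← card_biUnion, ← card_image_of_injective (f := fun n : ℕ => (n, n + 1)) _
        (fun a b hab => congrArg Prod.fst hab), ← card_union_of_disjoint]
      · apply card_le_card
        rintro ⟨i, j⟩ hij
        rw [mem_union, mem_biUnion, mem_image] at hij
        simp only [ppCnt, mem_filter, mem_product, mem_Icc]
        rcases hij with ⟨pq, hpq, hij⟩ | ⟨n, hn, hne⟩
        · simp only [maximalIntervals, mem_filter, mem_product, mem_Icc] at hpq
          simp only [ppBd, mem_filter, mem_product, mem_Icc] at hij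
          refine ⟨by omega, by omega, hij.2.2.1, hij.2.2.2.trans ?_⟩
          rw [hε]; norm_num
        · rw [mem_filter, mem_Icc] at hn
          rw [Prod.mk.injEq] at hne
          obtain ⟨rfl, rfl⟩ := hne
          rw [← hgdef]
          exact ⟨by omega, by omega, not_le.1 hn.2, hgap n hn.1.1⟩
      · rw [disjoint_left]
        rintro ⟨i, j⟩ h1 h2
        rw [mem_biUnion] at h1
        rw [mem_image] at h2
        obtain ⟨pq, hpq, hij⟩ := h1
        obtain ⟨n, hn, hne⟩ := h2
        rw [mem_filter] at hn
        rw [Prod.mk.injEq] at hne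
        obtain ⟨rfl, rfl⟩ := hne
        simp only [maximalIntervals, mem_filter, mem_product, mem_Icc] at hpq
        simp only [ppBd, mem_filter, mem_product, mem_Icc] at hij
        exact hn.2 (hpq.2.2.1 n (by omega))
      · intro u hu v hv huv
        rw [Function.onFun, disjoint_left]
        rintro ⟨i, j⟩ h1 h2
        simp only [ppBd, mem_filter, mem_product, mem_Icc] at h1 h2
        exact huv (pp_maxint_unique g N i u v hu hv (by omega) (by omega) (by omega) (by omega))
    have hsum := sum_le_sum fun pq hpq => (hrc pq hpq).2.2.2.2
    rw [sum_add_distrib, ← mul_sum, ← mul_sum, ← mul_sum] at hsum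
    have hpart := card_filter_add_card_filter_not (s := Icc 1 N) (fun n : ℕ => g n ≤ 1 / 2)
    rw [Nat.card_Icc, Nat.add_sub_cancel] at hpart
    generalize ∑ pq ∈ maximalIntervals g N, (ppBd lam pq.1 (pq.2 + 1)).card = B at *
    generalize ∑ pq ∈ maximalIntervals g N, (ppGd lam pq.1 (pq.2 + 1)).card = G at *
    generalize ∑ pq ∈ maximalIntervals g N,
      ∑ k ∈ range (r pq), (c pq (k + 1) - c pq k + 1).choose 2 = W at *
    have hs : (100 : ℝ) * G ≤ 104 * W + 10000 * B := by exact_mod_cast hsum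
    have hp' : (((Icc 1 N).filter fun n => g n ≤ 1 / 2).card : ℝ) +
      (((Icc 1 N).filter fun n => ¬ g n ≤ 1 / 2).card : ℝ) = N := by exact_mod_cast hpart
    have hB' : (B : ℝ) + (((Icc 1 N).filter fun n => ¬ g n ≤ 1 / 2).card : ℝ) ≤
      ((ppCnt lam (1 / 2) (3 / 2 + ε) N).card : ℝ) := by exact_mod_cast hBt
    have hG' : ((ppCnt lam 0 (1 / 2) N).card : ℝ) ≤ G := by exact_mod_cast hGt
    have hs2 : (1.4 : ℝ) ≤ Real.sqrt 2 := Real.le_sqrt_of_sq_le (by norm_num)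
    have he : (0.005 : ℝ) ≤ ε ^ ((1 : ℝ) / 4) := by
      have h1 : ((0.005 : ℝ) ^ (4 : ℝ)) ^ ((1 : ℝ) / 4) = 0.005 := by
        rw [← Real.rpow_mul (by norm_num)]; norm_num
      rw [← h1]
      apply Real.rpow_le_rpow (by positivity) _ (by norm_num)
      rw [hε]
      norm_num
    have hprod : (1.4 : ℝ) * 0.005 ≤ Real.sqrt 2 * ε ^ ((1 : ℝ) / 4) :=
      mul_le_mul hs2 he (by norm_num) (by positivity)
    have hN : (0 : ℝ) ≤ N := Nat.cast_nonneg N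
    have hfin : (1 / 2 - 4 * Real.sqrt 2 * ε ^ ((1 : ℝ) / 4)) * N ≤ 0.472 * N := by
      apply mul_le_mul_of_nonneg_right _ hN
      linarith
    refine hfin.trans ?_
    linarith
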